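/- Let l = 5, let r be 1 or 2, and set a = [r]. Then p_{16,4}(1/a) and p_{32,12}(1/a) lie in the subring S of L generated over ℤ/2 by [1] and [2]. -/

import Mathlib

open scoped Classical

/-- The theta series `[i]` for modulus `l`: `∑ x^(n²)` over integers `n ≡ i (mod l)`,
viewed in `ℤ/2[[x]]` (the coefficient of `x^k` is the mod-2 count of such `n` with `n² = k`). -/
noncomputable def theta (l i : ℤ) : PowerSeries (ZMod 2) :=
  PowerSeries.mk fun k => (({n : ℤ | n ≡ i [ZMOD l] ∧ n ^ 2 = (k : ℤ)}.ncard : ℕ) : ZMod 2)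

/-- The theta series viewed in the Laurent series field `L = ℤ/2((x))`. -/
noncomputable def thetaL (l i : ℤ) : LaurentSeries (ZMod 2) := (theta l i : LaurentSeries (ZMod 2))

/-- The projection `p_{q,j}` keeping only the coefficients in degrees `≡ j (mod q)`. -/
noncomputable def proj (q j : ℤ) (f : LaurentSeries (ZMod 2)) : LaurentSeries (ZMod 2) where
  coeff n := if n ≡ j [ZMOD q] then f.coeff n else 0
  isPWO_support' := f.isPWO_support'.mono (fun n hn => by
    simp only [Function.mem_support, ne_eq] at hn ⊢
    intro h; apply hn; split_ifs <;> simp [h])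

/-- `B(g)`: the set of integers `n` such that the coefficient of `x^n` in `1/g` is `1`. -/
noncomputable def Bset (g : PowerSeries (ZMod 2)) : Set ℤ :=
  {n : ℤ | ((g : LaurentSeries (ZMod 2))⁻¹).coeff n = 1}

/-- The subring `S` of `L` generated over `ℤ/2` by `[1], …, [m]`. -/
noncomputable def Sring (l : ℤ) (m : ℕ) : Subring (LaurentSeries (ZMod 2)) :=
  Subring.closure {x | ∃ i : ℕ, 1 ≤ i ∧ i ≤ m ∧ x = thetaL l i}

/-- The subring `S` of `ℤ/2[[x]]` generated over `ℤ/2` by `[1], …, [m]`. -/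
noncomputable def SringPS (l : ℤ) (m : ℕ) : Subring (PowerSeries (ZMod 2)) :=
  Subring.closure {x | ∃ i : ℕ, 1 ≤ i ∧ i ≤ m ∧ x = theta l i}

theorem PowerSeries.two_eq_zero_of_zmod_two : (2 : PowerSeries (ZMod 2)) = 0 := by
  rw [← map_ofNat (PowerSeries.C (R := ZMod 2)) 2, show (OfNat.ofNat 2 : ZMod 2) = 0 from rfl,
    map_zero]

theorem LaurentSeries.two_eq_zero_of_zmod_two : (2 : LaurentSeries (ZMod 2)) = 0 := by
  rw [← map_ofNat (HahnSeries.ofPowerSeries ℤ (ZMod 2)) 2, PowerSeries.two_eq_zero_of_zmod_two,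
    map_zero]

section Projection

variable {f g : LaurentSeries (ZMod 2)} {q i j : ℤ}

theorem coeff_proj (q j : ℤ) (f : LaurentSeries (ZMod 2)) (n : ℤ) :
    (proj q j f).coeff n = if n ≡ j [ZMOD q] then f.coeff n else 0 := rfl

theorem coeff_sq_two_mul (f : LaurentSeries (ZMod 2)) (n : ℤ) :
    (f ^ 2).coeff (2 * n) = f.coeff n := by
  rw [sq, HahnSeries.coeff_mul]
  rw [← Finset.sum_filter_add_sum_filter_not _ (fun ij : ℤ × ℤ => ij = (n, n))]
  have h : ∑ ij ∈ (Finset.antidiagonal f.isPWO_support f.isPWO_support (2 * n)).filter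
      (fun ij : ℤ × ℤ => ¬ ij = (n, n)), f.coeff ij.1 * f.coeff ij.2 = 0 := by
    refine Finset.sum_involution (fun ij _ => ij.swap) ?_ ?_ ?_ ?_
    · intro ij _
      rw [Prod.fst_swap, Prod.snd_swap, mul_comm, CharTwo.add_self_eq_zero]
    · rintro ⟨a, b⟩ hab _ h
      simp only [Finset.mem_filter, Finset.mem_antidiagonal, Prod.swap_prod_mk,
        Prod.mk.injEq] at hab h
      omega
    · rintro ⟨a, b⟩ hab
      simp only [Finset.mem_filter, Finset.mem_antidiagonal, Prod.swap_prod_mk,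
        Prod.mk.injEq] at hab ⊢
      exact ⟨⟨hab.1.2.1, hab.1.1, by omega⟩, by omega⟩
    · intro ij _
      exact Prod.swap_swap ij
  rw [h, add_zero, Finset.sum_filter, Finset.sum_ite_eq']
  have hz : ∀ z : ZMod 2, z * z = z := by decide
  simp only [Finset.mem_antidiagonal, HahnSeries.mem_support, hz]
  split_ifs with h'
  · rfl
  · by_contra hne
    exact h' ⟨Ne.symm hne, Ne.symm hne, by ring⟩

theorem coeff_sq_of_odd (f : LaurentSeries (ZMod 2)) {n : ℤ} (hn : Odd n) :
    (f ^ 2).coeff n = 0 := by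
  rw [sq, HahnSeries.coeff_mul]
  refine Finset.sum_involution (fun ij _ => ij.swap) ?_ ?_ ?_ ?_
  · intro ij _
    rw [Prod.fst_swap, Prod.snd_swap, mul_comm, CharTwo.add_self_eq_zero]
  · rintro ⟨a, b⟩ hab _ h
    simp only [Finset.mem_antidiagonal, Prod.swap_prod_mk, Prod.mk.injEq] at hab h
    obtain ⟨k, hk⟩ := hn
    omega
  · rintro ⟨a, b⟩ hab
    simp only [Finset.mem_antidiagonal, Prod.swap_prod_mk] at hab ⊢
    exact ⟨hab.2.1, hab.1, by omega⟩
  · intro ij _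
    exact Prod.swap_swap ij

theorem proj_add (q j : ℤ) (f g : LaurentSeries (ZMod 2)) :
    proj q j (f + g) = proj q j f + proj q j g := by
  ext n
  simp only [coeff_proj, HahnSeries.coeff_add]
  split_ifs <;> simp

theorem proj_sq (q j : ℤ) (f : LaurentSeries (ZMod 2)) :
    proj (2 * q) (2 * j) (f ^ 2) = proj q j f ^ 2 := by
  ext n
  rcases Int.even_or_odd' n with ⟨m, rfl | rfl⟩
  · rw [coeff_proj, coeff_sq_two_mul, coeff_sq_two_mul, coeff_proj]
    have : 2 * m ≡ 2 * j [ZMOD 2 * q] ↔ m ≡ j [ZMOD q] := by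
      rw [Int.modEq_iff_dvd, Int.modEq_iff_dvd, ← mul_sub,
        mul_dvd_mul_iff_left (two_ne_zero)]
    simp only [this]
  · rw [coeff_proj, coeff_sq_of_odd _ ⟨m, rfl⟩, coeff_sq_of_odd _ ⟨m, rfl⟩, ite_self]

theorem proj_pow_four (q j : ℤ) (f : LaurentSeries (ZMod 2)) :
    proj (4 * q) (4 * j) (f ^ 4) = proj q j f ^ 4 := by
  calc proj (4 * q) (4 * j) (f ^ 4) = proj (2 * (2 * q)) (2 * (2 * j)) ((f ^ 2) ^ 2) := by
        rw [← pow_mul, ← mul_assoc, ← mul_assoc]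
        norm_num
    _ = proj q j f ^ 4 := by rw [proj_sq, proj_sq, ← pow_mul]

theorem proj_proj {q' j' : ℤ} (hq : q' ∣ q) (hj : j ≡ j' [ZMOD q'])
    (f : LaurentSeries (ZMod 2)) : proj q j (proj q' j' f) = proj q j f := by
  ext n
  simp only [coeff_proj]
  split_ifs with h h'
  · rfl
  · exact absurd ((h.of_dvd hq).trans hj) h'
  · rfl

/-- The series `f` is supported in degrees congruent to `j` modulo `q`. -/
def SupportedMod (q j : ℤ) (f : LaurentSeries (ZMod 2)) : Prop :=
  ∀ n, f.coeff n ≠ 0 → n ≡ j [ZMOD q]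

theorem supportedMod_proj (q j : ℤ) (f : LaurentSeries (ZMod 2)) :
    SupportedMod q j (proj q j f) := by
  intro n hn
  rw [coeff_proj] at hn
  by_contra h
  exact hn (if_neg h)

namespace SupportedMod

theorem proj_eq_self (hf : SupportedMod q i f) (hij : i ≡ j [ZMOD q]) : proj q j f = f := by
  ext n
  rw [coeff_proj]
  split_ifs with h
  · rfl
  · by_contra hne
    exact h ((hf n (Ne.symm hne)).trans hij)

theorem proj_eq_zero (hf : SupportedMod q i f) (hij : ¬ i ≡ j [ZMOD q]) : proj q j f = 0 := by
  ext n
  rw [coeff_proj, HahnSeries.coeff_zero]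
  split_ifs with h
  · by_contra hne
    exact hij ((hf n hne).symm.trans h)
  · rfl

theorem of_dvd {q' : ℤ} (hf : SupportedMod q j f) (h : q' ∣ q) : SupportedMod q' j f :=
  fun n hn => (hf n hn).of_dvd h

theorem add (hf : SupportedMod q j f) (hg : SupportedMod q j g) : SupportedMod q j (f + g) := by
  have h := supportedMod_proj q j (f + g)
  rwa [proj_add, hf.proj_eq_self rfl, hg.proj_eq_self rfl] at h

theorem mul (hf : SupportedMod q i f) (hg : SupportedMod q j g) :
    SupportedMod q (i + j) (f * g) := by
  intro n hn
  rw [HahnSeries.coeff_mul] at hn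
  obtain ⟨⟨a, b⟩, hab, -⟩ := Finset.exists_ne_zero_of_sum_ne_zero hn
  rw [Finset.mem_antidiagonal] at hab
  obtain ⟨ha, hb, rfl⟩ := hab
  exact (hf a ha).add (hg b hb)

theorem sq (hf : SupportedMod q j f) : SupportedMod (2 * q) (2 * j) (f ^ 2) := by
  have h := supportedMod_proj (2 * q) (2 * j) (f ^ 2)
  rwa [proj_sq, hf.proj_eq_self rfl] at h

theorem proj_mul (hf : SupportedMod q i f) (g : LaurentSeries (ZMod 2)) :
    proj q (i + j) (f * g) = f * proj q j g := by
  have hg : proj q (i + j) (f * (g - proj q j g)) = 0 := by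
    ext n
    rw [coeff_proj, HahnSeries.coeff_zero]
    split_ifs with hn
    · by_contra hne
      rw [HahnSeries.coeff_mul] at hne
      obtain ⟨⟨a, b⟩, hab, -⟩ := Finset.exists_ne_zero_of_sum_ne_zero hne
      rw [Finset.mem_antidiagonal] at hab
      obtain ⟨ha, hb, rfl⟩ := hab
      have hbj : b ≡ j [ZMOD q] := Int.ModEq.add_left_cancel (hf a ha) hn
      apply hb
      rw [HahnSeries.coeff_sub, coeff_proj, if_pos hbj, sub_self]
    · rfl
  have h : f * g = f * proj q j g + f * (g - proj q j g) := by ring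
  rw [h, proj_add, hg, add_zero, (hf.mul (supportedMod_proj q j g)).proj_eq_self rfl]

end SupportedMod

theorem supportedMod_pow_four (f : LaurentSeries (ZMod 2)) : SupportedMod 4 0 (f ^ 4) := by
  have h : SupportedMod 1 0 f := fun n _ => Int.modEq_one
  have h4 := h.sq.sq
  rwa [← pow_mul] at h4

end Projection

section Counting

variable {ι κ : Type*}

/-- The series `∑ x^(w t)` over `t ∈ S`, with coefficients counted modulo 2. -/
noncomputable def weightSeries (S : Set ι) (w : ι → ℤ) : PowerSeries (ZMod 2) :=
  PowerSeries.mk fun k => (({t : ι | t ∈ S ∧ w t = (k : ℤ)}.ncard : ℕ) : ZMod 2)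

theorem coeff_weightSeries (S : Set ι) (w : ι → ℤ) (k : ℕ) :
    PowerSeries.coeff k (weightSeries S w) =
      (({t : ι | t ∈ S ∧ w t = (k : ℤ)}.ncard : ℕ) : ZMod 2) :=
  PowerSeries.coeff_mk _ _

theorem theta_eq_weightSeries (l i : ℤ) :
    theta l i = weightSeries {n : ℤ | n ≡ i [ZMOD l]} (fun n => n ^ 2) := rfl

theorem weightSeries_eq_of_bijOn {S : Set ι} {T : Set κ} {w : ι → ℤ} {v : κ → ℤ} (f : ι → κ)
    (hf : Set.BijOn f S T) (hw : ∀ t ∈ S, v (f t) = w t) :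
    weightSeries S w = weightSeries T v := by
  ext k
  rw [coeff_weightSeries, coeff_weightSeries]
  congr 1
  refine Set.ncard_congr (fun t _ => f t) ?_ ?_ ?_
  · rintro t ⟨ht, hk⟩
    exact ⟨hf.mapsTo ht, (hw t ht).trans hk⟩
  · rintro t s ⟨ht, -⟩ ⟨hs, -⟩ h
    exact hf.injOn ht hs h
  · rintro u ⟨hu, hk⟩
    obtain ⟨t, ht, rfl⟩ := hf.surjOn hu
    exact ⟨t, ⟨ht, (hw t ht).symm.trans hk⟩, rfl⟩

theorem weightSeries_union {S T : Set ι} (hST : Disjoint S T) {w : ι → ℤ}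
    (hw : ∀ k : ℤ, {t | w t = k}.Finite) :
    weightSeries (S ∪ T) w = weightSeries S w + weightSeries T w := by
  ext k
  rw [map_add, coeff_weightSeries, coeff_weightSeries, coeff_weightSeries, ← Nat.cast_add,
    ← Set.ncard_union_eq _ ((hw k).subset fun _ h => h.2) ((hw k).subset fun _ h => h.2)]
  · congr 2
    ext t
    simp only [Set.mem_union, Set.mem_ofPred_eq]
    tauto
  · exact hST.mono (fun _ h => h.1) (fun _ h => h.1)

theorem weightSeries_mul {S : Set ι} {T : Set κ} {w : ι → ℤ} {v : κ → ℤ}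
    (hw : ∀ t, 0 ≤ w t) (hv : ∀ t, 0 ≤ v t)
    (hwv : ∀ k : ℤ, {p : ι × κ | w p.1 + v p.2 = k}.Finite) :
    weightSeries S w * weightSeries T v =
      weightSeries (S ×ˢ T) (fun p => w p.1 + v p.2) := by
  ext k
  rw [PowerSeries.coeff_mul, coeff_weightSeries]
  have hfin : {p : ι × κ | p ∈ S ×ˢ T ∧ w p.1 + v p.2 = (k : ℤ)}.Finite :=
    (hwv k).subset fun _ h => h.2
  rw [Set.ncard_eq_toFinset_card _ hfin, Finset.card_eq_sum_card_fiberwise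
    (f := fun p => ((w p.1).toNat, (v p.2).toNat)) (t := Finset.HasAntidiagonal.antidiagonal k)]
  · rw [Nat.cast_sum]
    refine Finset.sum_congr rfl ?_
    rintro ⟨a, b⟩ hab
    rw [Finset.HasAntidiagonal.mem_antidiagonal] at hab
    rw [coeff_weightSeries, coeff_weightSeries, ← Nat.cast_mul, ← Set.ncard_prod,
      ← Set.ncard_coe_finset]
    congr 2
    ext ⟨s, t⟩
    have := hw s
    have := hv t
    simp only [Set.mem_prod, Set.mem_ofPred_eq, Finset.coe_filter, Set.Finite.mem_toFinset,
      Prod.mk.injEq]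
    constructor
    · rintro ⟨⟨hs, hsa⟩, ht, htb⟩
      exact ⟨⟨⟨hs, ht⟩, by omega⟩, by omega, by omega⟩
    · rintro ⟨⟨⟨hs, ht⟩, h⟩, ha, hb⟩
      exact ⟨⟨hs, by omega⟩, ht, by omega⟩
  · rintro ⟨s, t⟩ h
    have := hw s
    have := hv t
    simp only [Finset.mem_coe, Set.Finite.mem_toFinset, Set.mem_ofPred_eq,
      Finset.HasAntidiagonal.mem_antidiagonal] at h ⊢
    omega

theorem weightSeries_two_mul (S : Set ι) (w : ι → ℤ) :
    weightSeries S (fun t => 2 * w t) = weightSeries S w ^ 2 := by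
  apply HahnSeries.ofPowerSeries_injective (Γ := ℤ)
  rw [map_pow]
  ext n
  rcases lt_or_ge n 0 with hn | hn
  · rw [PowerSeries.coeff_coe, if_pos hn]
    rcases Int.even_or_odd' n with ⟨m, rfl | rfl⟩
    · rw [coeff_sq_two_mul, PowerSeries.coeff_coe, if_pos (by omega)]
    · rw [coeff_sq_of_odd _ ⟨m, rfl⟩]
  · lift n to ℕ using hn
    rw [LaurentSeries.coeff_coe_powerSeries, coeff_weightSeries]
    rcases Nat.even_or_odd' n with ⟨m, rfl | rfl⟩
    · rw [Nat.cast_mul, Nat.cast_two, coeff_sq_two_mul, LaurentSeries.coeff_coe_powerSeries,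
        coeff_weightSeries]
      congr 3
      ext t
      refine and_congr_right fun _ => ?_
      omega
    · rw [coeff_sq_of_odd _ ⟨(m : ℤ), by push_cast; ring⟩]
      have : {t : ι | t ∈ S ∧ 2 * w t = ((2 * m + 1 : ℕ) : ℤ)} = ∅ := by
        ext t
        simp only [Set.mem_ofPred_eq, Set.mem_empty_iff_false, iff_false, not_and]
        intro _
        omega
      rw [this, Set.ncard_empty, Nat.cast_zero]

theorem weightSeries_four_mul (S : Set ι) (w : ι → ℤ) :
    weightSeries S (fun t => 4 * w t) = weightSeries S w ^ 4 := by
  calc weightSeries S (fun t => 4 * w t) = weightSeries S (fun t => 2 * (2 * w t)) := by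
        congr 1
        ext t
        ring
    _ = weightSeries S w ^ 4 := by rw [weightSeries_two_mul, weightSeries_two_mul, ← pow_mul]

theorem finite_sq_eq (k : ℤ) : {n : ℤ | n ^ 2 = k}.Finite :=
  (Set.finite_Icc (-k) k).subset fun n (hn : n ^ 2 = k) => by
    constructor <;> nlinarith [Int.le_self_sq n, Int.le_self_sq (-n)]

theorem finite_sq_add_sq_eq (k : ℤ) : {p : ℤ × ℤ | p.1 ^ 2 + p.2 ^ 2 = k}.Finite :=
  ((Set.finite_Icc (-k) k).prod (Set.finite_Icc (-k) k)).subset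
    fun p (hp : p.1 ^ 2 + p.2 ^ 2 = k) => by
      have := Int.le_self_sq p.1
      have := Int.le_self_sq (-p.1)
      have := Int.le_self_sq p.2
      have := Int.le_self_sq (-p.2)
      refine ⟨⟨?_, ?_⟩, ?_, ?_⟩ <;> nlinarith [sq_nonneg p.1, sq_nonneg p.2]

end Counting

section Theta

/-- The part `∑ x^(n²)`, over `n ≡ i (mod 5)` odd, of the theta series `[i]`. -/
noncomputable def oddTheta (i : ℤ) : PowerSeries (ZMod 2) :=
  weightSeries {n : ℤ | n % 5 = i % 5 ∧ n % 2 = 1} (fun n => n ^ 2)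

theorem weightSeries_even_eq {i j ε : ℤ} (hε : ε = 1 ∨ ε = -1)
    (hij : (i - 2 * ε * j) % 5 = 0) :
    weightSeries {n : ℤ | n % 5 = i % 5 ∧ n % 2 = 0} (fun n => n ^ 2) = theta 5 j ^ 4 := by
  rw [theta_eq_weightSeries, ← weightSeries_four_mul]
  symm
  have hsq : ε ^ 2 = 1 := by rcases hε with rfl | rfl <;> norm_num
  refine weightSeries_eq_of_bijOn (fun n => 2 * ε * n) ⟨?_, ?_, ?_⟩
    fun n _ => by linear_combination 4 * n ^ 2 * hsq
  · intro n hn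
    simp only [Set.mem_ofPred_eq, Int.ModEq] at hn ⊢
    rcases hε with rfl | rfl <;> omega
  · intro m _ n _ h
    simp only at h
    rcases hε with rfl | rfl <;> omega
  · intro n hn
    simp only [Set.mem_image, Set.mem_ofPred_eq, Int.ModEq] at hn ⊢
    refine ⟨ε * (n / 2), ?_, ?_⟩ <;> rcases hε with rfl | rfl <;> omega

theorem theta_eq_add_oddTheta {i j ε : ℤ} (hε : ε = 1 ∨ ε = -1)
    (hij : (i - 2 * ε * j) % 5 = 0) :
    theta 5 i = theta 5 j ^ 4 + oddTheta i := by
  rw [← weightSeries_even_eq hε hij, oddTheta, ← weightSeries_union _ finite_sq_eq,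
    theta_eq_weightSeries]
  · congr 1
    ext n
    simp only [Set.mem_ofPred_eq, Set.mem_union, Int.ModEq]
    omega
  · rw [Set.disjoint_left]
    rintro n ⟨_, h⟩ ⟨_, h'⟩
    omega

theorem oddTheta_mul_oddTheta :
    oddTheta 1 * oddTheta 2 =
      (oddTheta 1 * theta 5 1 ^ 4 + theta 5 2 ^ 4 * oddTheta 2) ^ 2 := by
  have hn : ∀ n : ℤ, 0 ≤ n ^ 2 := sq_nonneg
  rw [← weightSeries_even_eq (i := 2) (j := 1) (Or.inl rfl) (by norm_num),
    ← weightSeries_even_eq (i := 1) (j := 2) (Or.inr rfl) (by norm_num), oddTheta, oddTheta,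
    weightSeries_mul hn hn finite_sq_add_sq_eq, weightSeries_mul hn hn finite_sq_add_sq_eq,
    weightSeries_mul hn hn finite_sq_add_sq_eq, ← weightSeries_union _ finite_sq_add_sq_eq,
    ← weightSeries_two_mul]
  · symm
    refine weightSeries_eq_of_bijOn (fun p => (p.2 - p.1, -p.1 - p.2)) ⟨?_, ?_, ?_⟩
      fun p _ => by ring
    · rintro ⟨u, v⟩ h
      simp only [Set.mem_union, Set.mem_prod, Set.mem_ofPred_eq] at h ⊢
      omega
    · rintro ⟨u, v⟩ _ ⟨u', v'⟩ _ h
      simp only [Prod.mk.injEq] at h ⊢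
      omega
    · rintro ⟨m, n⟩ h
      simp only [Set.mem_image, Set.mem_union, Set.mem_prod, Set.mem_ofPred_eq, Prod.exists,
        Prod.mk.injEq] at h ⊢
      exact ⟨-((m + n) / 2), (m - n) / 2, by omega, by omega⟩
  · rw [Set.disjoint_left]
    rintro ⟨u, v⟩ h h'
    simp only [Set.mem_prod, Set.mem_ofPred_eq] at h h'
    omega

theorem constantCoeff_theta {i : ℤ} (hi : i % 5 ≠ 0) :
    PowerSeries.constantCoeff (theta 5 i) = 0 := by
  rw [← PowerSeries.coeff_zero_eq_constantCoeff_apply, theta_eq_weightSeries, coeff_weightSeries]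
  have : {n : ℤ | n ∈ {n : ℤ | n ≡ i [ZMOD 5]} ∧ n ^ 2 = ((0 : ℕ) : ℤ)} = ∅ := by
    ext n
    simp only [Set.mem_ofPred_eq, Set.mem_empty_iff_false, iff_false, not_and, Int.ModEq]
    rintro h h0
    have : n = 0 := by simpa using h0
    omega
  rw [this, Set.ncard_empty, Nat.cast_zero]

theorem theta_one_eq : theta 5 1 = theta 5 2 ^ 4 + oddTheta 1 :=
  theta_eq_add_oddTheta (Or.inr rfl) (by norm_num)

theorem theta_two_eq : theta 5 2 = theta 5 1 ^ 4 + oddTheta 2 :=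
  theta_eq_add_oddTheta (Or.inl rfl) (by norm_num)

theorem theta_ne_zero {i : ℕ} (hi : i % 5 ≠ 0) : theta 5 i ≠ 0 := by
  intro h
  have hc := congrArg (PowerSeries.coeff (i ^ 2)) h
  have hset : {n : ℤ | n ∈ {n : ℤ | n ≡ i [ZMOD 5]} ∧ n ^ 2 = ((i ^ 2 : ℕ) : ℤ)} = {(i : ℤ)} := by
    ext n
    simp only [Set.mem_ofPred_eq, Set.mem_singleton_iff, Int.ModEq, Nat.cast_pow,
      sq_eq_sq_iff_eq_or_eq_neg]
    omega
  rw [theta_eq_weightSeries, coeff_weightSeries, hset, Set.ncard_singleton, map_zero] at hc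
  simp at hc

theorem theta_relation :
    theta 5 1 ^ 5 + theta 5 2 ^ 5 = theta 5 1 * theta 5 2 + theta 5 1 ^ 2 * theta 5 2 ^ 2 := by
  have h1 := theta_one_eq
  have h2 := theta_two_eq
  have h := oddTheta_mul_oddTheta
  have ha := constantCoeff_theta (i := 1) (by norm_num)
  have hb := constantCoeff_theta (i := 2) (by norm_num)
  generalize theta 5 1 = a at *
  generalize theta 5 2 = b at *
  have two := PowerSeries.two_eq_zero_of_zmod_two
  rw [← sub_eq_iff_eq_add'.mpr h1, ← sub_eq_iff_eq_add'.mpr h2] at h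
  have key : (a ^ 5 + b ^ 5 - (a * b + a ^ 2 * b ^ 2)) *
      (a ^ 5 + b ^ 5 - (a * b + a ^ 2 * b ^ 2) - 1) = 0 := by
    linear_combination (-1) * h + (a ^ 2 * b ^ 2 + a ^ 4 * b ^ 4 - (a ^ 5 + b ^ 5) * (a * b) -
      (a ^ 5 + b ^ 5) * (a ^ 2 * b ^ 2) + a ^ 3 * b ^ 3 - (a ^ 5 + b ^ 5) + a * b +
      2 * (a ^ 5 + b ^ 5) * (a ^ 4 * b ^ 4) - 2 * (a ^ 8 * b ^ 8)) * two
  rcases mul_eq_zero.mp key with h0 | h0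
  · exact sub_eq_zero.mp h0
  · have := congrArg PowerSeries.constantCoeff h0
    simp [ha, hb] at this

theorem supportedMod_oddTheta (i : ℤ) :
    SupportedMod 8 1 (oddTheta i : LaurentSeries (ZMod 2)) := by
  intro k hk
  rw [PowerSeries.coeff_coe] at hk
  split_ifs at hk with hk0
  · exact absurd rfl hk
  rw [oddTheta, coeff_weightSeries] at hk
  have hne : {n : ℤ | n ∈ {n : ℤ | n % 5 = i % 5 ∧ n % 2 = 1} ∧
      n ^ 2 = (k.natAbs : ℤ)}.ncard ≠ 0 := fun h => hk (by rw [h, Nat.cast_zero])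
  obtain ⟨n, ⟨-, hn⟩, hnk⟩ := Set.nonempty_of_ncard_ne_zero hne
  rw [Int.natAbs_of_nonneg (not_lt.mp hk0)] at hnk
  rw [← hnk]
  exact (Int.modEq_iff_dvd.mpr (Int.eight_dvd_sq_sub_one_of_odd (Int.odd_iff.mpr hn))).symm

end Theta

section Inverse

variable {a b o o' : LaurentSeries (ZMod 2)}

theorem proj_four_zero_inv (ha : a ≠ 0) (ho : SupportedMod 8 1 o) (hao : a = b ^ 4 + o) :
    proj 4 0 a⁻¹ = (b ^ 3 * a⁻¹) ^ 4 := by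
  have ho4 : SupportedMod 4 1 o := ho.of_dvd (by norm_num)
  have hb := supportedMod_pow_four b
  have hi := supportedMod_pow_four a⁻¹
  have hoo : SupportedMod 4 2 (o ^ 2) := by
    have := ho4.mul ho4
    rwa [← sq] at this
  have hbb : SupportedMod 4 0 ((b ^ 4) ^ 2) := by
    have := hb.mul hb
    rwa [← sq] at this
  have key : a⁻¹ = (a⁻¹) ^ 4 * (b ^ 4 * (b ^ 4) ^ 2) + (a⁻¹) ^ 4 * (o * (b ^ 4) ^ 2) +
      (a⁻¹) ^ 4 * (b ^ 4 * o ^ 2) + (a⁻¹) ^ 4 * (o * o ^ 2) := by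
    have h : a⁻¹ = a⁻¹ ^ 4 * (a * a ^ 2) := by field_simp
    have hsq : a ^ 2 = (b ^ 4) ^ 2 + o ^ 2 := by
      linear_combination (a + b ^ 4 + o) * hao +
        b ^ 4 * o * LaurentSeries.two_eq_zero_of_zmod_two
    linear_combination h + a⁻¹ ^ 4 * a * hsq + a⁻¹ ^ 4 * ((b ^ 4) ^ 2 + o ^ 2) * hao
  conv_lhs => rw [key]
  rw [proj_add, proj_add, proj_add, (hi.mul (hb.mul hbb)).proj_eq_self (by decide),
    (hi.mul (ho4.mul hbb)).proj_eq_zero (by decide), (hi.mul (hb.mul hoo)).proj_eq_zero (by decide),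
    (hi.mul (ho4.mul hoo)).proj_eq_zero (by decide)]
  ring

/-- The two projections of `1/a`, for series `a`, `b` whose parts `o`, `o'` of odd degree have
complements `b ^ 4`, `a ^ 4` and which satisfy the quintic relation of the theta series. -/
theorem proj_inv_eq (ha : a ≠ 0) (ho : SupportedMod 8 1 o) (ho' : SupportedMod 8 1 o')
    (hao : a = b ^ 4 + o) (hbo : b = a ^ 4 + o')
    (hD : o * o' = (o * a ^ 4 + b ^ 4 * o') ^ 2)
    (hrel : a ^ 5 + b ^ 5 = a * b + a ^ 2 * b ^ 2) :
    proj 16 4 a⁻¹ = ((a ^ 5 + b ^ 5) * b ^ 4) ^ 4 ∧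
      proj 32 12 a⁻¹ =
        ((a ^ 5 + b ^ 5) ^ 2 * (a + b ^ 4) + (a ^ 5 + b ^ 5) ^ 2 * (b + a ^ 4) * b ^ 8) ^ 4 := by
  have two : (2 : LaurentSeries (ZMod 2)) = 0 :=
    LaurentSeries.two_eq_zero_of_zmod_two
  have ho4 : SupportedMod 4 1 o := ho.of_dvd (by norm_num)
  have ho4' : SupportedMod 4 1 o' := ho'.of_dvd (by norm_num)
  have eo : o = a + b ^ 4 := by linear_combination (-1) * hao - b ^ 4 * two
  have eo' : o' = b + a ^ 4 := by linear_combination (-1) * hbo - a ^ 4 * two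
  set D := o * a ^ 4 + b ^ 4 * o' with hDdef
  have eD : D = a ^ 5 + b ^ 5 := by
    rw [hDdef, eo, eo']
    linear_combination a ^ 4 * b ^ 4 * two
  have hD4 : SupportedMod 4 1 D :=
    (ho4.mul (supportedMod_pow_four a)).add ((supportedMod_pow_four b).mul ho4')
  have hDD : SupportedMod 8 2 (D ^ 2) := hD4.sq
  have hDD4 : SupportedMod 4 2 (D ^ 2) := hDD.of_dvd (by norm_num)
  have hZ : SupportedMod 4 0 (a ^ 4 * b ^ 4) :=
    (supportedMod_pow_four a).mul (supportedMod_pow_four b)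
  have hab : a * b = a ^ 4 * b ^ 4 + D ^ 2 + D := by
    have h : (a + b ^ 4) * (b + a ^ 4) = D ^ 2 := by rw [← eo, ← eo', hD]
    linear_combination h - eD - (a ^ 4 * b ^ 4 + a ^ 5 + b ^ 5) * two
  have hsum : a ^ 4 * b ^ 4 + D ^ 2 = a ^ 2 * b ^ 2 := by
    linear_combination (-1) * hab - eD - hrel - a ^ 2 * b ^ 2 * two
  have hQ : SupportedMod 4 0 ((a ^ 2 * b ^ 2) ^ 2) := by
    have := supportedMod_pow_four (a * b)
    rwa [show (a * b) ^ 4 = (a ^ 2 * b ^ 2) ^ 2 by ring] at this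
  have hi := supportedMod_pow_four a⁻¹
  have key : b ^ 3 * a⁻¹ =
      a⁻¹ ^ 4 * ((a ^ 4 * b ^ 4) * (a ^ 2 * b ^ 2) ^ 2) +
      a⁻¹ ^ 4 * ((a ^ 4 * b ^ 4) * D ^ 2) +
      a⁻¹ ^ 4 * (D ^ 2 * (a ^ 2 * b ^ 2) ^ 2) +
      a⁻¹ ^ 4 * (D ^ 2 * D ^ 2) +
      a⁻¹ ^ 4 * (D * (a ^ 2 * b ^ 2) ^ 2) +
      a⁻¹ ^ 4 * (D * D ^ 2) := by
    have h1 : b ^ 3 * a⁻¹ = a⁻¹ ^ 4 * ((a * b) * (a * b) ^ 2) := by field_simp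
    have h2 : (a * b) ^ 2 = (a ^ 2 * b ^ 2) ^ 2 + D ^ 2 := by
      rw [hab, hsum]
      linear_combination a ^ 2 * b ^ 2 * D * two
    rw [h1, h2, hab]
    ring
  have p1 : proj 4 1 (b ^ 3 * a⁻¹) = D * b ^ 4 := by
    rw [key]
    simp only [proj_add]
    rw [(hi.mul (hZ.mul hQ)).proj_eq_zero (by decide),
      (hi.mul (hZ.mul hDD4)).proj_eq_zero (by decide),
      (hi.mul (hDD4.mul hQ)).proj_eq_zero (by decide),
      (hi.mul (hDD4.mul hDD4)).proj_eq_zero (by decide),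
      (hi.mul (hD4.mul hQ)).proj_eq_self (by decide),
      (hi.mul (hD4.mul hDD4)).proj_eq_zero (by decide)]
    field_simp
    ring
  have p3 : proj 4 3 (b ^ 3 * a⁻¹) = D ^ 2 * o + (D ^ 2 * o') * (b * a⁻¹) ^ 4 := by
    rw [key]
    simp only [proj_add]
    rw [(hi.mul (hZ.mul hQ)).proj_eq_zero (by decide),
      (hi.mul (hZ.mul hDD4)).proj_eq_zero (by decide),
      (hi.mul (hDD4.mul hQ)).proj_eq_zero (by decide),
      (hi.mul (hDD4.mul hDD4)).proj_eq_zero (by decide),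
      (hi.mul (hD4.mul hQ)).proj_eq_zero (by decide),
      (hi.mul (hD4.mul hDD4)).proj_eq_self (by decide)]
    nth_rw 1 [hDdef]
    field_simp
    ring
  have p0 : proj 2 0 (b * a⁻¹) = b ^ 2 := by
    have h1 : b * a⁻¹ = a⁻¹ ^ 2 * (a * b) ^ 1 := by field_simp
    have hi2 : SupportedMod 2 0 (a⁻¹ ^ 2) :=
      SupportedMod.sq (q := 1) (j := 0) fun _ _ => Int.modEq_one
    have hD2 : SupportedMod 2 1 D := hD4.of_dvd (by norm_num)
    have hQ2 : SupportedMod 2 0 ((a * b) ^ 2) :=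
      SupportedMod.sq (q := 1) (j := 0) fun _ _ => Int.modEq_one
    rw [h1, pow_one, hab, hsum, ← mul_pow, mul_add, proj_add, (hi2.mul hQ2).proj_eq_self (by decide),
      (hi2.mul hD2).proj_eq_zero (by decide)]
    field_simp
    ring
  have p8 : proj 8 3 (b ^ 3 * a⁻¹) = D ^ 2 * o + D ^ 2 * o' * b ^ 8 := by
    rw [← proj_proj (q := 8) (j := 3) (q' := 4) (j' := 3) (by norm_num) rfl, p3, proj_add,
      (hDD.mul ho).proj_eq_self (by decide)]
    have h : proj 8 3 (D ^ 2 * o' * (b * a⁻¹) ^ 4) = D ^ 2 * o' * proj 8 0 ((b * a⁻¹) ^ 4) :=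
      (hDD.mul ho').proj_mul (j := 0) _
    have h4 : proj 8 0 ((b * a⁻¹) ^ 4) = proj 2 0 (b * a⁻¹) ^ 4 := proj_pow_four 2 0 _
    rw [h, h4, p0, ← pow_mul]
  have h0 := proj_four_zero_inv ha ho hao
  constructor
  · rw [← proj_proj (q := 16) (j := 4) (q' := 4) (j' := 0) (by norm_num) rfl, h0, ← eD, ← p1]
    exact proj_pow_four 4 1 _
  · rw [← proj_proj (q := 32) (j := 12) (q' := 4) (j' := 0) (by norm_num) rfl, h0, ← eD, ← eo, ← eo', ← p8]
    exact proj_pow_four 8 3 _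

end Inverse

theorem proj_inv_mem {R : Subring (LaurentSeries (ZMod 2))} {a b o o' : LaurentSeries (ZMod 2)}
    (haR : a ∈ R) (hbR : b ∈ R) (ha : a ≠ 0)
    (ho : SupportedMod 8 1 o) (ho' : SupportedMod 8 1 o')
    (hao : a = b ^ 4 + o) (hbo : b = a ^ 4 + o')
    (hD : o * o' = (o * a ^ 4 + b ^ 4 * o') ^ 2)
    (hrel : a ^ 5 + b ^ 5 = a * b + a ^ 2 * b ^ 2) :
    proj 16 4 a⁻¹ ∈ R ∧ proj 32 12 a⁻¹ ∈ R := by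
  obtain ⟨h1, h2⟩ := proj_inv_eq ha ho ho' hao hbo hD hrel
  have hP := R.add_mem (R.pow_mem haR 5) (R.pow_mem hbR 5)
  rw [h1, h2]
  refine ⟨R.pow_mem (R.mul_mem hP (R.pow_mem hbR 4)) 4, R.pow_mem (R.add_mem ?_ ?_) 4⟩
  · exact R.mul_mem (R.pow_mem hP 2) (R.add_mem haR (R.pow_mem hbR 4))
  · exact R.mul_mem (R.mul_mem (R.pow_mem hP 2) (R.add_mem hbR (R.pow_mem haR 4)))
      (R.pow_mem hbR 8)

theorem stmt18 (r : ℤ) (hr : r = 1 ∨ r = 2) :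
    proj 16 4 (thetaL 5 r)⁻¹ ∈ Sring 5 2 ∧ proj 32 12 (thetaL 5 r)⁻¹ ∈ Sring 5 2 := by
  have hmem1 : thetaL 5 1 ∈ Sring 5 2 := Subring.subset_closure ⟨1, by norm_num, by norm_num, rfl⟩
  have hmem2 : thetaL 5 2 ∈ Sring 5 2 := Subring.subset_closure ⟨2, by norm_num, by norm_num, rfl⟩
  have hne1 : thetaL 5 1 ≠ 0 :=
    (map_ne_zero_iff _ HahnSeries.ofPowerSeries_injective).mpr
      (theta_ne_zero (i := 1) (by norm_num))
  have hne2 : thetaL 5 2 ≠ 0 :=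
    (map_ne_zero_iff _ HahnSeries.ofPowerSeries_injective).mpr
      (theta_ne_zero (i := 2) (by norm_num))
  have ho1 := supportedMod_oddTheta 1
  have ho2 := supportedMod_oddTheta 2
  have h1 := congrArg (HahnSeries.ofPowerSeries ℤ (ZMod 2)) theta_one_eq
  have h2 := congrArg (HahnSeries.ofPowerSeries ℤ (ZMod 2)) theta_two_eq
  have hD := congrArg (HahnSeries.ofPowerSeries ℤ (ZMod 2)) oddTheta_mul_oddTheta
  have hrel := congrArg (HahnSeries.ofPowerSeries ℤ (ZMod 2)) theta_relation
  simp only [map_add, map_mul, map_pow] at h1 h2 hD hrel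
  rcases hr with rfl | rfl
  · exact proj_inv_mem hmem1 hmem2 hne1 ho1 ho2 h1 h2 hD hrel
  · refine proj_inv_mem hmem2 hmem1 hne2 ho2 ho1 h2 h1 ?_ ?_
    · simp only [thetaL]
      linear_combination hD
    · simp only [thetaL]
      linear_combination hrel
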